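/- arXiv:2206.09405 — 6 statements merged into one kernel-verified Lean document; each statement's English description precedes it below -/
import Mathlib

section
/- Let β₁, β₂ : ℍ×ℂ → ℝ be the Betti coordinate functions β₂(τ,z) = Im z / Im τ and β₁(τ,z) = Im(τ·conj(z)) / Im τ (so that z = β₁ + β₂τ). Then for every (τ,z) ∈ ℍ×ℂ and all v = (v_τ, v_z), w = (w_τ, w_z) ∈ ℂ², writing Dβ₁, Dβ₂ for the ℝ-Fréchet derivatives at (τ,z), one has Dβ₁(v)·Dβ₂(w) − Dβ₁(w)·Dβ₂(v) = Im( conj(v_z − β₂·v_τ)·(w_z − β₂·w_τ) ) / Im τ, where β₂ = β₂(τ,z). (This is the statement that the 2-form dβ₁ ∧ dβ₂ is globally defined, independent of the choice of abelian logarithm, and equals the invariant semi-definite Kähler form μ = i∂∂̄((Im z)²/Im τ) = 2i·Im τ·∂β₂ ∧ ∂̄β₂.) -/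
/-- The first Betti coordinate `β₁(τ,z) = Im (τ·conj z) / Im τ` on `ℍ × ℂ`. -/
noncomputable def beta1 (p : ℂ × ℂ) : ℝ := (p.1 * (starRingEnd ℂ) p.2).im / p.1.im

/-- The second Betti coordinate `β₂(τ,z) = Im z / Im τ` on `ℍ × ℂ`. -/
noncomputable def beta2 (p : ℂ × ℂ) : ℝ := p.2.im / p.1.im

theorem hasFDerivAt_beta2 (τ z : ℂ) (hτ : τ.im ≠ 0) :
    HasFDerivAt beta2
      (τ.im⁻¹ • (Complex.imCLM.comp (ContinuousLinearMap.snd ℝ ℂ ℂ) -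
        beta2 (τ, z) • Complex.imCLM.comp (ContinuousLinearMap.fst ℝ ℂ ℂ))) (τ, z) := by
  have hnum : HasFDerivAt (fun p : ℂ × ℂ => p.2.im)
      (Complex.imCLM.comp (ContinuousLinearMap.snd ℝ ℂ ℂ)) (τ, z) :=
    (Complex.imCLM.comp (ContinuousLinearMap.snd ℝ ℂ ℂ)).hasFDerivAt
  have hden : HasFDerivAt (fun p : ℂ × ℂ => p.1.im)
      (Complex.imCLM.comp (ContinuousLinearMap.fst ℝ ℂ ℂ)) (τ, z) :=
    (Complex.imCLM.comp (ContinuousLinearMap.fst ℝ ℂ ℂ)).hasFDerivAt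
  have hinv := (hasDerivAt_inv (x := (τ, z).1.im) hτ).comp_hasFDerivAt (τ, z) hden
  have hquot := hnum.mul hinv
  refine hquot.congr_fderiv ?_
  ext v <;> simp [beta2] <;> field_simp

theorem fderiv_beta2_apply (τ z : ℂ) (hτ : τ.im ≠ 0) (v : ℂ × ℂ) :
    fderiv ℝ beta2 (τ, z) v = (v.2.im - beta2 (τ, z) * v.1.im) / τ.im := by
  rw [(hasFDerivAt_beta2 τ z hτ).fderiv]
  simp [div_eq_inv_mul]

/-- The real part of the relation `z = β₁ + β₂ τ`. -/
theorem beta1_eq_re_sub (p : ℂ × ℂ) (hp : p.1.im ≠ 0) :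
    beta1 p = p.2.re - beta2 p * p.1.re := by
  simp only [beta1, beta2, Complex.mul_im, Complex.conj_re, Complex.conj_im]
  field_simp
  ring

theorem fderiv_beta1_apply (τ z : ℂ) (hτ : τ.im ≠ 0) (v : ℂ × ℂ) :
    fderiv ℝ beta1 (τ, z) v =
      v.2.re - beta2 (τ, z) * v.1.re - τ.re * fderiv ℝ beta2 (τ, z) v := by
  have hz : HasFDerivAt (fun p : ℂ × ℂ => p.2.re)
      (Complex.reCLM.comp (ContinuousLinearMap.snd ℝ ℂ ℂ)) (τ, z) :=
    (Complex.reCLM.comp (ContinuousLinearMap.snd ℝ ℂ ℂ)).hasFDerivAt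
  have ht : HasFDerivAt (fun p : ℂ × ℂ => p.1.re)
      (Complex.reCLM.comp (ContinuousLinearMap.fst ℝ ℂ ℂ)) (τ, z) :=
    (Complex.reCLM.comp (ContinuousLinearMap.fst ℝ ℂ ℂ)).hasFDerivAt
  have hev : beta1 =ᶠ[nhds (τ, z)] fun p => p.2.re - beta2 p * p.1.re := by
    have hcont : Continuous fun p : ℂ × ℂ => p.1.im := by fun_prop
    filter_upwards [hcont.continuousAt.eventually_ne hτ] with p hp
    exact beta1_eq_re_sub p hp
  have h := hz.fun_sub ((hasFDerivAt_beta2 τ z hτ).differentiableAt.hasFDerivAt.fun_mul ht)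
  rw [hev.fderiv_eq, h.fderiv]
  simp
  ring

/-- For `(τ,z) ∈ ℍ × ℂ` and tangent vectors `v = (v_τ,v_z)`, `w = (w_τ,w_z)` in `ℂ²`, writing
`Dβ₁, Dβ₂` for the ℝ-Fréchet derivatives at `(τ,z)`, one has
`Dβ₁(v)·Dβ₂(w) − Dβ₁(w)·Dβ₂(v) = Im( conj(v_z − β₂·v_τ)·(w_z − β₂·w_τ) ) / Im τ`,
i.e. `dβ₁ ∧ dβ₂` is globally defined and equals the invariant form
`μ = i∂∂̄((Im z)²/Im τ) = 2i·Im τ·∂β₂ ∧ ∂̄β₂`. -/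
theorem stmt_2 (τ z : ℂ) (hτ : 0 < τ.im) (vτ vz wτ wz : ℂ) :
    fderiv ℝ beta1 (τ, z) (vτ, vz) * fderiv ℝ beta2 (τ, z) (wτ, wz)
        - fderiv ℝ beta1 (τ, z) (wτ, wz) * fderiv ℝ beta2 (τ, z) (vτ, vz)
      = ((starRingEnd ℂ) (vz - (beta2 (τ, z) : ℂ) * vτ)
          * (wz - (beta2 (τ, z) : ℂ) * wτ)).im / τ.im := by
  have hne := hτ.ne'
  rw [fderiv_beta1_apply τ z hne, fderiv_beta1_apply τ z hne, fderiv_beta2_apply τ z hne,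
    fderiv_beta2_apply τ z hne]
  simp only [Complex.mul_im, Complex.conj_re, Complex.conj_im, Complex.sub_re, Complex.sub_im,
    Complex.mul_re, Complex.ofReal_re, Complex.ofReal_im]
  ring
end

section
/- Let Ω ⊆ ℍ be open and s : Ω → ℂ be holomorphic. Define b₂(τ) := Im s(τ)/Im τ and b₁(τ) := Im(τ·conj(s(τ)))/Im τ (so that s(τ) = b₁(τ) + b₂(τ)·τ with b₁, b₂ real-valued). Then for every τ ∈ Ω the Wirtinger derivatives satisfy ∂b₂/∂τ(τ) = (s'(τ) − b₂(τ))/(2i·Im τ) and ∂b₁/∂τ(τ) = −conj(τ)·∂b₂/∂τ(τ). (Equivalently, the verticality η of the section τ ↦ (τ, s(τ)) satisfies η = 2i·Im τ·∂b₂ = (2·Im τ/(i·conj(τ)))·∂b₁.) -/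
/-- The (1,0)-Wirtinger derivative `∂f/∂τ` of a function `f : ℂ → ℂ` at a point. -/
noncomputable def wdz (f : ℂ → ℂ) (w : ℂ) : ℂ :=
  (1 / 2) * (fderiv ℝ f w 1 - Complex.I * fderiv ℝ f w Complex.I)

/-- The Wirtinger derivative in terms of a given real Fréchet derivative. -/
theorem HasFDerivAt.wdz_eq {f : ℂ → ℂ} {L : ℂ →L[ℝ] ℂ} {w : ℂ} (h : HasFDerivAt f L w) :
    wdz f w = (1 / 2) * (L 1 - Complex.I * L Complex.I) := by
  rw [wdz, h.fderiv]

/-- The quotient `Im s(τ) / Im τ` is real differentiable wherever `s` is holomorphic and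
`Im τ ≠ 0`, with the derivative given by the quotient rule. -/
theorem hasFDerivAt_im_div_im {s : ℂ → ℂ} {s' τ : ℂ} (hs : HasDerivAt s s' τ) (hτ : τ.im ≠ 0) :
    ∃ L : ℂ →L[ℝ] ℂ, HasFDerivAt (fun w => (((s w).im / w.im : ℝ) : ℂ)) L τ ∧
      ∀ v, L v = ((((s' * v).im * τ.im - (s τ).im * v.im) / τ.im ^ 2 : ℝ) : ℂ) := by
  have hsR := hs.hasFDerivAt.restrictScalars ℝ
  have hnum := Complex.imCLM.hasFDerivAt.comp τ hsR
  have hinv := (hasDerivAt_inv hτ).comp_hasFDerivAt τ Complex.imCLM.hasFDerivAt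
  have hquot := hnum.mul hinv
  refine ⟨_, Complex.ofRealCLM.hasFDerivAt.comp τ hquot, fun v => ?_⟩
  simp
  field_simp
  ring

/-- A complex number off the real axis gives real coordinates: `z = β₁ + β₂ τ`. -/
theorem im_mul_conj_div_im_eq (z : ℂ) {τ : ℂ} (hτ : τ.im ≠ 0) :
    (((τ * (starRingEnd ℂ) z).im / τ.im : ℝ) : ℂ) = z - ((z.im / τ.im : ℝ) : ℂ) * τ := by
  apply Complex.ext
  · simp
    field_simp
    ring
  · simp
    field_simp
    simp

/-- Let `Ω ⊆ ℍ` be open and `s : Ω → ℂ` holomorphic, and let `b₂(τ) = Im s(τ)/Im τ`,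
`b₁(τ) = Im(τ·conj s(τ))/Im τ` be the pullbacks of the Betti coordinates. Then for every
`τ ∈ Ω` one has `∂b₂/∂τ = (s'(τ) − b₂(τ))/(2i·Im τ)` and `∂b₁/∂τ = −conj(τ)·∂b₂/∂τ`. -/
theorem stmt_5 (Ω : Set ℂ) (hΩ : IsOpen Ω) (hΩH : ∀ τ ∈ Ω, 0 < τ.im)
    (s : ℂ → ℂ) (hs : DifferentiableOn ℂ s Ω)
    (b1 b2 : ℂ → ℝ)
    (hb2 : ∀ τ, b2 τ = (s τ).im / τ.im)
    (hb1 : ∀ τ, b1 τ = (τ * (starRingEnd ℂ) (s τ)).im / τ.im) :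
    ∀ τ ∈ Ω,
      wdz (fun w => ((b2 w : ℝ) : ℂ)) τ
          = (deriv s τ - ((b2 τ : ℝ) : ℂ)) / (2 * Complex.I * (τ.im : ℂ)) ∧
      wdz (fun w => ((b1 w : ℝ) : ℂ)) τ
          = -(starRingEnd ℂ) τ * wdz (fun w => ((b2 w : ℝ) : ℂ)) τ := by
  intro τ hτ
  have him : τ.im ≠ 0 := (hΩH τ hτ).ne'
  have hsτ : HasDerivAt s (deriv s τ) τ := (hs.differentiableAt (hΩ.mem_nhds hτ)).hasDerivAt
  obtain ⟨L, hL, hLv⟩ := hasFDerivAt_im_div_im hsτ him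
  have h2 : HasFDerivAt (fun w => ((b2 w : ℝ) : ℂ)) L τ := by simpa only [hb2] using hL
  have hw2 : wdz (fun w => ((b2 w : ℝ) : ℂ)) τ
      = (deriv s τ - ((b2 τ : ℝ) : ℂ)) / (2 * Complex.I * (τ.im : ℂ)) := by
    rw [h2.wdz_eq, hLv, hLv, hb2]
    rw [eq_div_iff (by simp [him])]
    apply Complex.ext <;> simp [-Complex.ofReal_sub, -Complex.ofReal_mul,
      -Complex.ofReal_div, -Complex.ofReal_pow] <;> field_simp
  refine ⟨hw2, ?_⟩
  have h1 : HasFDerivAt (fun w => ((b1 w : ℝ) : ℂ)) _ τ :=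
    ((hsτ.hasFDerivAt.restrictScalars ℝ).sub
      (h2.mul (hasFDerivAt_id τ))).congr_of_eventuallyEq <| by
      filter_upwards [hΩ.mem_nhds hτ] with w hw
      simpa [hb1, hb2] using im_mul_conj_div_im_eq (s w) (hΩH w hw).ne'
  have hη : deriv s τ - ((b2 τ : ℝ) : ℂ)
      = 2 * Complex.I * (τ.im : ℂ) * wdz (fun w => ((b2 w : ℝ) : ℂ)) τ := by
    rw [hw2, mul_div_cancel₀]
    simp [him]
  have hconj : (starRingEnd ℂ) τ = τ - 2 * τ.im * Complex.I := by
    rw [← Complex.ofReal_ofNat, ← Complex.ofReal_mul, ← Complex.sub_conj]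
    ring
  have hw1 : wdz (fun w => ((b1 w : ℝ) : ℂ)) τ
      = (deriv s τ - ((b2 τ : ℝ) : ℂ)) - τ * wdz (fun w => ((b2 w : ℝ) : ℂ)) τ := by
    rw [h1.wdz_eq, h2.wdz_eq]
    simp
    linear_combination (-(1 / 2) * (deriv s τ - ((b2 τ : ℝ) : ℂ))) * Complex.I_sq
  rw [hw1, hη, hconj]
  ring
end

section
/- Let Ω ⊆ ℍ be open and s : Ω → ℂ be holomorphic, and define η(τ) := s'(τ) − Im s(τ)/Im τ. Then η is smooth and for every τ ∈ Ω its (0,1)-Wirtinger derivative satisfies ∂η/∂τ̄(τ) = −i·conj(η(τ))/(2·Im τ). (This is the first-order differential equation ∂̄η_σ = −i·conj(η_σ) ⊗ g⋆^{−1/2} satisfied by the verticality of a holomorphic section.) -/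
/-- The (0,1)-Wirtinger derivative `∂f/∂τ̄` of a function `f : ℂ → ℂ` at a point. -/
noncomputable def wdzbar (f : ℂ → ℂ) (w : ℂ) : ℂ :=
  (1 / 2) * (fderiv ℝ f w 1 + Complex.I * fderiv ℝ f w Complex.I)

/-- The `∂/∂τ̄` derivative computed from a real Fréchet derivative. -/
lemma HasFDerivAt.wdzbar_eq {f : ℂ → ℂ} {f' : ℂ →L[ℝ] ℂ} {w : ℂ} (h : HasFDerivAt f f' w) :
    wdzbar f w = (1 / 2) * (f' 1 + Complex.I * f' Complex.I) := by
  rw [wdzbar, h.fderiv]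

/-- Let `Ω ⊆ ℍ` be open, `s : Ω → ℂ` holomorphic, and `η(τ) = s'(τ) − Im s(τ)/Im τ` the
verticality of the section `τ ↦ (τ, s(τ))`. Then `η` is smooth on `Ω` and satisfies the
first-order differential equation `∂η/∂τ̄(τ) = −i·conj(η(τ))/(2·Im τ)` for every `τ ∈ Ω`. -/
theorem stmt_6 (Ω : Set ℂ) (hΩ : IsOpen Ω) (hΩH : ∀ τ ∈ Ω, 0 < τ.im)
    (s : ℂ → ℂ) (hs : DifferentiableOn ℂ s Ω)
    (η : ℂ → ℂ) (hη : ∀ τ, η τ = deriv s τ - (((s τ).im / τ.im : ℝ) : ℂ)) :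
    ContDiffOn ℝ (⊤ : ℕ∞) η Ω ∧
      ∀ τ ∈ Ω, wdzbar η τ
        = -Complex.I * (starRingEnd ℂ) (η τ) / (2 * (τ.im : ℂ)) := by
  obtain rfl : η = fun τ ↦ deriv s τ - (((s τ).im * (τ.im)⁻¹ : ℝ) : ℂ) := by
    simpa only [div_eq_mul_inv] using funext hη
  have hs' : DifferentiableOn ℂ (deriv s) Ω := hs.deriv hΩ
  refine ⟨?_, fun τ hτ ↦ ?_⟩
  · have him : ContDiffOn ℝ (⊤ : ℕ∞) (fun τ ↦ (s τ).im) Ω :=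
      Complex.imCLM.contDiff.comp_contDiffOn ((hs.contDiffOn hΩ).restrict_scalars ℝ)
    have hquot : ContDiffOn ℝ (⊤ : ℕ∞) (fun τ ↦ (s τ).im * (τ.im)⁻¹) Ω :=
      him.mul (Complex.imCLM.contDiff.contDiffOn.inv fun τ hτ ↦ (hΩH τ hτ).ne')
    exact ((hs'.contDiffOn hΩ).restrict_scalars ℝ).sub
      (Complex.ofRealCLM.contDiff.comp_contDiffOn hquot)
  · have hy : τ.im ≠ 0 := (hΩH τ hτ).ne'
    have hyC : (τ.im : ℂ) ≠ 0 := Complex.ofReal_ne_zero.mpr hy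
    have hd : HasFDerivAt s _ τ :=
      (hs.differentiableAt (hΩ.mem_nhds hτ)).hasDerivAt.hasFDerivAt.restrictScalars ℝ
    have hd' : HasFDerivAt (deriv s) _ τ :=
      (hs'.differentiableAt (hΩ.mem_nhds hτ)).hasDerivAt.hasFDerivAt.restrictScalars ℝ
    have hquot := (Complex.imCLM.hasFDerivAt.comp τ hd).mul
      ((hasDerivAt_inv hy).comp_hasFDerivAt τ Complex.imCLM.hasFDerivAt)
    have hη' := hd'.sub (Complex.ofRealCLM.hasFDerivAt.comp τ hquot)
    refine (HasFDerivAt.wdzbar_eq hη').trans ?_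
    have hconj : (starRingEnd ℂ) (deriv s τ) = (deriv s τ).re - (deriv s τ).im * Complex.I := by
      apply Complex.ext <;> simp
    simp [hconj]
    field_simp
    ring_nf
    simp
end

section
/- Let Ω ⊆ ℍ be open and connected and s : Ω → ℂ be holomorphic, and define η(τ) := s'(τ) − Im s(τ)/Im τ. If η is not identically zero on Ω, then the zero set of η is discrete in Ω: for every τ₀ ∈ Ω with η(τ₀) = 0 there is a punctured neighborhood of τ₀ on which η is nowhere zero. -/
/-- A holomorphic function `f` with a zero at `z₀` in the upper half-plane that does not vanish
identically near `z₀` satisfies `f' ≠ Im f / Im z` on a punctured neighborhood of `z₀`, because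
`f` is small compared with `f'` there. -/
lemma eventually_deriv_ne_im_div_im {f : ℂ → ℂ} {z₀ : ℂ} (hf : AnalyticAt ℂ f z₀)
    (him : 0 < z₀.im) (hz₀ : f z₀ = 0) (hne : ¬ ∀ᶠ z in nhds z₀, f z = 0) :
    ∀ᶠ z in nhds z₀, z ≠ z₀ → deriv f z ≠ (((f z).im / z.im : ℝ) : ℂ) := by
  obtain ⟨n, g, hg, hg0, hfg⟩ := hf.exists_eventuallyEq_pow_smul_nonzero_iff.mpr hne
  obtain ⟨m, rfl⟩ : ∃ m, n = m + 1 := by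
    refine Nat.exists_eq_succ_of_ne_zero fun hn => hg0 ?_
    have h := hfg.self_of_nhds
    simpa [hn, hz₀] using h.symm
  have hcg := hg.continuousAt
  have hcg' := hg.deriv.continuousAt
  have hcim : ContinuousAt Complex.im z₀ := Complex.continuous_im.continuousAt
  have hlt : ∀ᶠ z in nhds z₀,
      ‖z - z₀‖ * ‖g z‖ < ‖((m : ℂ) + 1) * g z + (z - z₀) * deriv g z‖ * z.im := by
    refine ContinuousAt.eventually_lt (by fun_prop) (by fun_prop) ?_
    have hm : (m : ℂ) + 1 ≠ 0 := Nat.cast_add_one_ne_zero m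
    simp only [sub_self, norm_zero, zero_mul, add_zero]
    exact mul_pos (norm_pos_iff.mpr (mul_ne_zero hm hg0)) him
  filter_upwards [hlt, hfg, hfg.eventually_nhds, hg.eventually_analyticAt,
    hcim.eventually (lt_mem_nhds him)] with z hz hfz hfz' hgz hzim hzne heq
  have hd : deriv f z = (z - z₀) ^ m * (((m : ℂ) + 1) * g z + (z - z₀) * deriv g z) := by
    rw [Filter.EventuallyEq.deriv_eq hfz']
    have h := (((hasDerivAt_id z).sub_const z₀).fun_pow (m + 1)).fun_mul
      hgz.differentiableAt.hasDerivAt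
    refine (h.congr_deriv ?_).deriv
    simp only [id, Nat.add_sub_cancel]
    push_cast
    ring
  have hle : ‖deriv f z‖ * z.im ≤ ‖f z‖ := by
    rw [heq, Complex.norm_real, norm_div, Real.norm_of_nonneg hzim.le,
      div_mul_cancel₀ _ hzim.ne', Real.norm_eq_abs]
    exact Complex.abs_im_le_norm _
  have hpow : 0 < ‖z - z₀‖ ^ m := pow_pos (norm_pos_iff.mpr (sub_ne_zero.mpr hzne)) m
  rw [hd, hfz, smul_eq_mul, norm_mul, norm_mul, norm_pow, norm_pow, pow_succ] at hle
  have := mul_lt_mul_of_pos_left hz hpow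
  linarith

/-- Let `Ω ⊆ ℍ` be open and connected, `s : Ω → ℂ` holomorphic, and
`η(τ) = s'(τ) − Im s(τ)/Im τ` the verticality of the section `τ ↦ (τ, s(τ))`. If `η` is not
identically zero on `Ω`, then the zero set of `η` is discrete in `Ω`: every zero `τ₀ ∈ Ω` of
`η` has a punctured neighborhood on which `η` is nowhere zero. -/
theorem stmt_7 (Ω : Set ℂ) (hΩ : IsOpen Ω) (hconn : IsConnected Ω)
    (hΩH : ∀ τ ∈ Ω, 0 < τ.im)
    (s : ℂ → ℂ) (hs : DifferentiableOn ℂ s Ω)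
    (η : ℂ → ℂ) (hη : ∀ τ, η τ = deriv s τ - (((s τ).im / τ.im : ℝ) : ℂ))
    (hne : ¬ ∀ τ ∈ Ω, η τ = 0) :
    ∀ τ₀ ∈ Ω, η τ₀ = 0 →
      ∃ U ∈ nhds τ₀, U ⊆ Ω ∧ ∀ τ ∈ U, τ ≠ τ₀ → η τ ≠ 0 := by
  intro τ₀ hτ₀ _
  have him := hΩH τ₀ hτ₀
  set a : ℝ := (s τ₀).im / τ₀.im with ha
  set b : ℝ := (s τ₀).re - a * τ₀.re with hb
  set f : ℂ → ℂ := fun τ => s τ - (a * τ + b) with hf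
  have hfd : DifferentiableOn ℂ f Ω := hs.sub (by fun_prop)
  have hηf : ∀ τ ∈ Ω, η τ = deriv f τ - (((f τ).im / τ.im : ℝ) : ℂ) := by
    intro τ hτ
    have hd : deriv f τ = deriv s τ - a := by
      have h := (hs.differentiableAt (hΩ.mem_nhds hτ)).hasDerivAt.fun_sub
        (((hasDerivAt_id τ).const_mul (a : ℂ)).add_const (b : ℂ))
      simpa using h.deriv
    have hi : (f τ).im / τ.im = (s τ).im / τ.im - a := by
      have := (hΩH τ hτ).ne'
      simp only [hf, Complex.sub_im, Complex.add_im,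
        Complex.im_ofReal_mul, Complex.ofReal_im]
      field_simp
      ring
    rw [hη, hd, hi]
    push_cast
    ring
  have hf0 : f τ₀ = 0 := by
    apply Complex.ext
    · simp [hf, hb]
    · simp [hf, ha, him.ne']
  have hnef : ¬ ∀ᶠ z in nhds τ₀, f z = 0 := by
    intro h
    have hE : Set.EqOn f 0 Ω :=
      (hfd.analyticOnNhd hΩ).eqOn_zero_of_preconnected_of_eventuallyEq_zero
        hconn.isPreconnected hτ₀ h
    refine hne fun τ hτ => ?_
    have hd : deriv f τ = 0 := by
      rw [(hE.eventuallyEq_of_mem (hΩ.mem_nhds hτ)).deriv_eq]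
      simp
    rw [hηf τ hτ, hd, hE hτ]
    simp
  refine ⟨_, Filter.inter_mem (hΩ.mem_nhds hτ₀) (eventually_deriv_ne_im_div_im
    (hfd.analyticAt (hΩ.mem_nhds hτ₀)) him hf0 hnef), Set.inter_subset_left, ?_⟩
  rintro τ ⟨hτ, h⟩ hττ₀
  rw [hηf τ hτ]
  exact sub_ne_zero.mpr (h hττ₀)
end

section
/- Let U ⊆ ℂ be an open neighborhood of 0 and let f : U → ℂ and G : U → ℂ be real-analytic (analytic over ℝ, viewing ℂ as ℝ²), with G nowhere zero on U. Suppose that the Wirtinger derivative satisfies ∂f/∂w̄(w) = G(w)·conj(f(w)) for all w ∈ U. Then either f vanishes identically on a neighborhood of 0, or there exist a nonnegative integer ℓ, a neighborhood V ⊆ U of 0, and a continuous function f♯ : V → ℂ with f♯(0) ≠ 0 and f♯ nowhere zero on V, such that f(w) = w^ℓ·f♯(w) for all w ∈ V. In particular, if f does not vanish identically near 0, then 0 is an isolated zero of f (if it is a zero at all). -/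
open Filter Topology Asymptotics

/-- The linear functional `L ↦ (L 1 + i L i) / 2` extracting the conjugate-linear part of a
real-linear endomorphism of `ℂ`. -/
noncomputable def conjLinearPart : (ℂ →L[ℝ] ℂ) →L[ℝ] ℂ :=
  (1 / 2 : ℂ) • (ContinuousLinearMap.apply ℝ ℂ (1 : ℂ) +
    Complex.I • ContinuousLinearMap.apply ℝ ℂ Complex.I)

lemma conjLinearPart_apply (L : ℂ →L[ℝ] ℂ) :
    conjLinearPart L = (1 / 2) * (L 1 + Complex.I * L Complex.I) := by
  simp [conjLinearPart, mul_add]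

lemma apply_eq_mul_of_conjLinearPart_eq_zero {L : ℂ →L[ℝ] ℂ} (h : conjLinearPart L = 0) (v : ℂ) :
    L v = v * L 1 := by
  rw [conjLinearPart_apply] at h
  have hI : L Complex.I = Complex.I * L 1 := by
    linear_combination (-2 * Complex.I) * h + L Complex.I * Complex.I_mul_I
  have hv : v = v.re • (1 : ℂ) + v.im • Complex.I := by
    simp [Complex.re_add_im]
  calc L v = L (v.re • (1 : ℂ) + v.im • Complex.I) := by rw [← hv]
    _ = (v.re • (1 : ℂ) + v.im • Complex.I) * L 1 := by
      rw [map_add, map_smul, map_smul, hI]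
      simp only [Complex.real_smul]
      ring
    _ = v * L 1 := by rw [← hv]

/-- If all derivatives of `g` of order at most `n` vanish at a point, so does the `n`-th derivative
of `f * conj g`. -/
lemma iteratedFDeriv_mul_conj_eq_zero {U : Set ℂ} (hU : IsOpen U) {f g : ℂ → ℂ}
    (hf : AnalyticOnNhd ℝ f U) (hg : AnalyticOnNhd ℝ g U) {x : ℂ} (hx : x ∈ U) {n : ℕ}
    (h : ∀ k ≤ n, iteratedFDeriv ℝ k g x = 0) :
    iteratedFDeriv ℝ n (fun w ↦ f w * (starRingEnd ℂ) (g w)) x = 0 := by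
  have hfd : ContDiffOn ℝ n f U := hf.contDiffOn hU.uniqueDiffOn
  have hgd : ContDiffOn ℝ n g U := hg.contDiffOn hU.uniqueDiffOn
  have hconj : ∀ k ≤ n, iteratedFDerivWithin ℝ k (fun w ↦ (starRingEnd ℂ) (g w)) U x = 0 := by
    intro k hk
    rw [iteratedFDerivWithin_of_isOpen k hU hx]
    have := (Complex.conjCLE : ℂ →L[ℝ] ℂ).iteratedFDeriv_comp_left
      (hgd.contDiffAt (hU.mem_nhds hx)) (i := k) (by exact_mod_cast hk)
    rw [h k hk] at this
    refine this.trans ?_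
    ext m
    simp
  have hle := norm_iteratedFDerivWithin_mul_le hfd
    ((Complex.conjCLE : ℂ →L[ℝ] ℂ).contDiff.comp_contDiffOn hgd) hU.uniqueDiffOn hx le_rfl
  rw [← iteratedFDerivWithin_of_isOpen n hU hx, ← norm_le_zero_iff]
  refine hle.trans (Finset.sum_nonpos fun i _ ↦ ?_)
  have := hconj (n - i) (Nat.sub_le _ _)
  simp only [Function.comp_def, ContinuousLinearEquiv.coe_coe, Complex.conjCLE_apply]
  rw [this]
  simp

/-- If the derivative of order `n - 1` of `∂f/∂w̄` vanishes at a point, the `n`-th derivative of `f`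
there is complex multilinear. -/
lemma iteratedFDeriv_eq_prod_mul {f : ℂ → ℂ} {x : ℂ} (hf : AnalyticAt ℝ f x) {n : ℕ}
    (h : ∀ k, k + 1 = n → iteratedFDeriv ℝ k (wdzbar f) x = 0) (m : Fin n → ℂ) :
    iteratedFDeriv ℝ n f x m = (∏ i, m i) * iteratedFDeriv ℝ n f x (fun _ ↦ 1) := by
  have hslot : ∀ (m : Fin n → ℂ) (j : Fin n) (v : ℂ),
      iteratedFDeriv ℝ n f x (Function.update m j v) =
        v * iteratedFDeriv ℝ n f x (Function.update m j 1) := by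
    intro m j v
    obtain _ | k := n
    · exact j.elim0
    have hw : wdzbar f = conjLinearPart ∘ fderiv ℝ f := by
      ext w
      simp [wdzbar, conjLinearPart_apply]
    have hk := h k rfl
    rw [hw, conjLinearPart.iteratedFDeriv_comp_left (n := k) hf.fderiv.contDiffAt le_rfl] at hk
    have hlast : ∀ (m : Fin (k + 1) → ℂ) (v : ℂ),
        iteratedFDeriv ℝ (k + 1) f x (Function.update m (Fin.last k) v) =
          v * iteratedFDeriv ℝ (k + 1) f x (Function.update m (Fin.last k) 1) := by
      intro m v
      simp only [iteratedFDeriv_succ_apply_right, Fin.init_update_last, Function.update_self]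
      exact apply_eq_mul_of_conjLinearPart_eq_zero
        (by simpa using DFunLike.congr_fun hk (Fin.init m)) v
    have hperm : ∀ v : ℂ, iteratedFDeriv ℝ (k + 1) f x (Function.update m j v) =
        iteratedFDeriv ℝ (k + 1) f x
          (Function.update (m ∘ Equiv.swap j (Fin.last k)) (Fin.last k) v) := by
      intro v
      rw [← hf.contDiffAt.iteratedFDeriv_comp_perm _ (Equiv.swap j (Fin.last k)),
        Function.update_comp_equiv]
      simp
    rw [hperm, hperm, hlast]
  let C : MultilinearMap ℂ (fun _ : Fin n ↦ ℂ) ℂ :=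
    { toFun := iteratedFDeriv ℝ n f x
      map_update_add' := fun {inst} m i u v ↦ (iteratedFDeriv ℝ n f x).map_update_add' m i u v
      map_update_smul' := fun {inst} m i c u ↦ by
        rw [Subsingleton.elim inst (instDecidableEqFin n), hslot, hslot m i u]
        simp [mul_assoc] }
  simpa [C] using C.map_smul_univ m (fun _ ↦ 1)

/-- An analytic function all of whose derivatives vanish at a point vanishes near that point. -/
lemma AnalyticAt.eventually_eq_zero_of_iteratedFDeriv {f : ℂ → ℂ} {x : ℂ} (hf : AnalyticAt ℝ f x)
    (h : ∀ n, iteratedFDeriv ℝ n f x = 0) : ∀ᶠ w in 𝓝 x, f w = 0 := by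
  obtain ⟨p, r, hp⟩ := hf
  filter_upwards [Metric.eball_mem_nhds x hp.r_pos] with w hw
  have := hp.hasSum_iteratedFDeriv (y := w - x) (by simpa [edist_eq_enorm_sub] using hw)
  rw [add_sub_cancel] at this
  refine this.unique ?_
  convert hasSum_zero with n
  rw [h n, zero_apply, smul_zero]

/-- Taylor's formula at order `n` for an analytic function whose derivatives of order less than `n`
vanish. -/
lemma AnalyticAt.isBigO_sub_iteratedFDeriv {f : ℂ → ℂ} {x : ℂ} (hf : AnalyticAt ℝ f x) {n : ℕ}
    (h : ∀ k < n, iteratedFDeriv ℝ k f x = 0) :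
    (fun y ↦ f (x + y) - (n.factorial : ℝ)⁻¹ • iteratedFDeriv ℝ n f x (fun _ ↦ y))
      =O[𝓝 0] fun y ↦ ‖y‖ ^ (n + 1) := by
  obtain ⟨p, r, hp⟩ := hf
  have hdiag : ∀ k y, p k (fun _ ↦ y) =
      (k.factorial : ℝ)⁻¹ • iteratedFDeriv ℝ k f x (fun _ ↦ y) := by
    intro k y
    rw [← hp.factorial_smul, ← Nat.cast_smul_eq_nsmul ℝ, inv_smul_smul₀]
    exact_mod_cast k.factorial_ne_zero
  refine (hp.hasFPowerSeriesAt.isBigO_sub_partialSum_pow (n + 1)).congr_left fun y ↦ ?_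
  rw [FormalMultilinearSeries.partialSum, Finset.sum_range_succ, Finset.sum_eq_zero, zero_add,
    hdiag]
  intro k hk
  rw [hdiag, h k (Finset.mem_range.1 hk)]
  simp

/-- A function asymptotic to `c * w ^ n` with `c ≠ 0` near `0`, up to `O(‖w‖ ^ (n + 1))`, factors as
`w ^ n` times a continuous nowhere zero function. -/
lemma exists_eq_pow_mul_of_isBigO {U : Set ℂ} (hU : U ∈ 𝓝 (0 : ℂ)) {f : ℂ → ℂ}
    (hf : ContinuousOn f U) {n : ℕ} {c : ℂ} (hc : c ≠ 0)
    (h : (fun w ↦ f w - w ^ n * c) =O[𝓝 0] fun w ↦ ‖w‖ ^ (n + 1)) :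
    ∃ (V : Set ℂ) (g : ℂ → ℂ), V ∈ 𝓝 (0 : ℂ) ∧ V ⊆ U ∧ ContinuousOn g V ∧ g 0 ≠ 0 ∧
      (∀ w ∈ V, g w ≠ 0) ∧ ∀ w ∈ V, f w = w ^ n * g w := by
  classical
  set g : ℂ → ℂ := Function.update (fun w ↦ f w / w ^ n) 0 c with hg
  have hg0 : g 0 = c := by simp [hg]
  have hgne : ∀ w ≠ 0, g w = f w / w ^ n := fun w hw ↦ by simp [hg, hw]
  obtain ⟨K, hK⟩ := h.bound
  have hcont : ContinuousAt g 0 := by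
    rw [ContinuousAt, hg0, tendsto_iff_norm_sub_tendsto_zero]
    refine squeeze_zero' (g := fun w : ℂ ↦ K * ‖w‖) (Eventually.of_forall fun _ ↦ norm_nonneg _)
      ?_ ?_
    · filter_upwards [hK] with w hw
      rcases eq_or_ne w 0 with rfl | hw0
      · simp [hg0]
      · have hpos : 0 < ‖w‖ ^ n := pow_pos (norm_pos_iff.2 hw0) n
        have : g w - c = (f w - w ^ n * c) / w ^ n := by
          rw [hgne w hw0]
          field_simp
        rw [this, norm_div, norm_pow, div_le_iff₀ hpos]
        refine hw.trans (le_of_eq ?_)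
        rw [norm_pow, norm_norm]
        ring
    · have : Continuous fun w : ℂ ↦ K * ‖w‖ := by fun_prop
      simpa using this.tendsto 0
  have hzero : f 0 = 0 ^ n * c := by
    have := hK.self_of_nhds
    simpa [sub_eq_zero] using this
  obtain ⟨V, hV, hVo, h0⟩ := mem_nhds_iff.1
    (inter_mem hU (hcont.eventually_ne (hg0.trans_ne hc)))
  refine ⟨V, g, hVo.mem_nhds h0, fun w hw ↦ (hV hw).1, fun w hw ↦ ?_, hg0.trans_ne hc,
    fun w hw ↦ (hV hw).2, fun w hw ↦ ?_⟩
  · rcases eq_or_ne w 0 with rfl | hw0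
    · exact hcont.continuousWithinAt
    · have hfw : ContinuousAt f w :=
        hf.continuousAt (mem_of_superset (hVo.mem_nhds hw) fun z hz ↦ (hV hz).1)
      refine ((hfw.div (continuousAt_id.pow n) (pow_ne_zero n hw0)).congr ?_).continuousWithinAt
      filter_upwards [isOpen_ne.mem_nhds hw0] with z hz
      exact (hgne z hz).symm
  · rcases eq_or_ne w 0 with rfl | hw0
    · rw [hg0, hzero]
    · rw [hgne w hw0]
      field_simp

/-- Let `U` be an open neighborhood of `0` in `ℂ`, and let `f, G : U → ℂ` be real-analytic with
`G` nowhere zero on `U`, satisfying `∂f/∂w̄ = G·conj f` on `U`. Then either `f` vanishes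
identically on a neighborhood of `0`, or there exist `ℓ ∈ ℕ`, a neighborhood `V ⊆ U` of `0` and
a continuous nowhere-zero `f♯ : V → ℂ` with `f(w) = w^ℓ·f♯(w)` on `V`; in particular `0` is an
isolated zero of `f` if `f` does not vanish identically near `0`. -/
theorem stmt_8 (U : Set ℂ) (hU : U ∈ nhds (0 : ℂ)) (hUopen : IsOpen U)
    (f G : ℂ → ℂ) (hf : AnalyticOnNhd ℝ f U) (hG : AnalyticOnNhd ℝ G U)
    (hGne : ∀ w ∈ U, G w ≠ 0)
    (heq : ∀ w ∈ U, wdzbar f w = G w * (starRingEnd ℂ) (f w)) :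
    (∃ V ∈ nhds (0 : ℂ), ∀ w ∈ V, f w = 0) ∨
      ∃ (ℓ : ℕ) (V : Set ℂ) (fs : ℂ → ℂ),
        V ∈ nhds (0 : ℂ) ∧ V ⊆ U ∧ ContinuousOn fs V ∧ fs 0 ≠ 0 ∧
        (∀ w ∈ V, fs w ≠ 0) ∧ ∀ w ∈ V, f w = w ^ ℓ * fs w := by
  have h0 : (0 : ℂ) ∈ U := mem_of_mem_nhds hU
  by_cases hall : ∀ n, iteratedFDeriv ℝ n f 0 = 0
  · exact .inl ⟨_, (hf 0 h0).eventually_eq_zero_of_iteratedFDeriv hall, fun _ hw ↦ hw⟩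
  classical
  push Not at hall
  obtain ⟨n, hn, hlt⟩ : ∃ n, iteratedFDeriv ℝ n f 0 ≠ 0 ∧
      ∀ k < n, iteratedFDeriv ℝ k f 0 = 0 :=
    ⟨Nat.find hall, Nat.find_spec hall, fun k hk ↦ not_not.1 (Nat.find_min hall hk)⟩
  have hprod := iteratedFDeriv_eq_prod_mul (hf 0 h0) (n := n) fun k hk ↦ by
    have heq' : wdzbar f =ᶠ[𝓝 0] fun w ↦ G w * (starRingEnd ℂ) (f w) := by
      filter_upwards [hU] with w hw using heq w hw
    rw [(heq'.iteratedFDeriv ℝ k).self_of_nhds]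
    exact iteratedFDeriv_mul_conj_eq_zero hUopen hG hf h0 fun j hj ↦ hlt j (by omega)
  have hc : iteratedFDeriv ℝ n f 0 (fun _ ↦ 1) ≠ 0 := fun hc ↦
    hn (ContinuousMultilinearMap.ext fun m ↦ by simp [hprod m, hc])
  have hfact : (n.factorial : ℝ)⁻¹ ≠ 0 := inv_ne_zero (by exact_mod_cast n.factorial_ne_zero)
  refine .inr ⟨n, exists_eq_pow_mul_of_isBigO hU hf.continuousOn (smul_ne_zero hfact hc)
    (((hf 0 h0).isBigO_sub_iteratedFDeriv hlt).congr_left fun w ↦ ?_)⟩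
  rw [hprod, zero_add]
  simp [mul_left_comm]
end

section
/- Let Ω ⊆ ℍ be open and connected and s : Ω → ℂ holomorphic, and define η(τ) := s'(τ) − Im s(τ)/Im τ. Then η vanishes identically on Ω if and only if there exist real numbers a, b with s(τ) = a + b·τ for all τ ∈ Ω; that is, the verticality of the section τ ↦ (τ, s(τ)) vanishes identically precisely when the section is horizontal, i.e., its Betti coordinates Im s(τ)/Im τ and Im(τ·conj(s(τ)))/Im τ are constant. -/
/-- Let `Ω ⊆ ℍ` be open and connected, `s : Ω → ℂ` holomorphic, and
`η(τ) = s'(τ) − Im s(τ)/Im τ` the verticality of the section `τ ↦ (τ, s(τ))`. Then `η`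
vanishes identically on `Ω` if and only if there are real numbers `a, b` with
`s(τ) = a + b·τ` on `Ω`, i.e. the section is horizontal (its Betti coordinates are
constant). -/
theorem stmt_16 (Ω : Set ℂ) (hΩ : IsOpen Ω) (hconn : IsConnected Ω)
    (hΩH : ∀ τ ∈ Ω, 0 < τ.im)
    (s : ℂ → ℂ) (hs : DifferentiableOn ℂ s Ω)
    (η : ℂ → ℂ) (hη : ∀ τ, η τ = deriv s τ - (((s τ).im / τ.im : ℝ) : ℂ)) :
    (∀ τ ∈ Ω, η τ = 0) ↔ ∃ a b : ℝ, ∀ τ ∈ Ω, s τ = (a : ℂ) + (b : ℂ) * τ := by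
  constructor
  · intro h
    have hderiv : ∀ τ ∈ Ω, deriv s τ = (((s τ).im / τ.im : ℝ) : ℂ) := fun τ hτ ↦
      sub_eq_zero.mp ((hη τ).symm.trans (h τ hτ))
    -- A holomorphic function with real values on a connected open set is constant.
    obtain ⟨c, hc⟩ := (hs.analyticOnNhd hΩ).deriv.eq_const_of_im_eq_const (c₀ := 0)
      (fun τ hτ ↦ by rw [hderiv τ hτ, Complex.ofReal_im]) hΩ hconn
    obtain ⟨τ₀, hτ₀⟩ := hconn.nonempty
    obtain ⟨b, rfl⟩ : ∃ b : ℝ, c = b := ⟨_, (hc τ₀ hτ₀).symm.trans (hderiv τ₀ hτ₀)⟩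
    have him : (s τ₀).im = b * τ₀.im := by
      have hb : (s τ₀).im / τ₀.im = b :=
        Complex.ofReal_injective ((hderiv τ₀ hτ₀).symm.trans (hc τ₀ hτ₀))
      exact (div_eq_iff (hΩH τ₀ hτ₀).ne').mp hb
    have hlin : ∀ τ, HasDerivAt (fun z : ℂ ↦ (b : ℂ) * z) b τ := fun τ ↦ by
      simpa using (hasDerivAt_id τ).const_mul (b : ℂ)
    obtain ⟨d, hd⟩ := hΩ.exists_is_const_of_deriv_eq_zero hconn.isPreconnected
      (hs.fun_sub fun τ _ ↦ (hlin τ).differentiableAt.differentiableWithinAt) fun τ hτ ↦ by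
        have hsτ := (hs.differentiableAt (hΩ.mem_nhds hτ)).hasDerivAt
        simpa [hc τ hτ] using (hsτ.fun_sub (hlin τ)).deriv
    have hdim : d.im = 0 := by
      rw [← hd τ₀ hτ₀, Complex.sub_im, Complex.im_ofReal_mul, him, sub_self]
    refine ⟨d.re, b, fun τ hτ ↦ ?_⟩
    have hdre : (d.re : ℂ) = d := Complex.ext rfl hdim.symm
    rw [hdre, ← hd τ hτ, sub_add_cancel]
  · rintro ⟨a, b, h⟩ τ hτ
    have hd : HasDerivAt s b τ := by
      have hlin : HasDerivAt (fun z : ℂ ↦ (a : ℂ) + (b : ℂ) * z) b τ := by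
        simpa using ((hasDerivAt_id τ).const_mul (b : ℂ)).const_add (a : ℂ)
      exact hlin.congr_of_eventuallyEq (Filter.eventually_of_mem (hΩ.mem_nhds hτ) h)
    have him : (s τ).im / τ.im = b := by
      rw [div_eq_iff (hΩH τ hτ).ne', h τ hτ]
      simp
    rw [hη, hd.deriv, him, sub_self]
end
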